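/- Let B(t) := (1+t)·log(1+t) − t for t > 0, and for p > 1 let m(p) := sup_{t > 0} B(t)/t^p. Then (p − 1)·m(p) → 1/e as p → 1 from the right. -/

import Mathlib

theorem m_aux_pow {t : ℝ} (ht : 0 < t) (p : ℝ) :
    t ^ p = t * Real.exp ((p - 1) * Real.log t) := by
  rw [Real.rpow_def_of_pos ht]
  nth_rewrite 2 [← Real.exp_log ht]
  rw [← Real.exp_add]
  congr 1
  ring

theorem m_aux_upper {p t : ℝ} (hp : 1 < p) (hp2 : p < 2) (ht : 0 < t) :
    ((1 + t) * Real.log (1 + t) - t) / t ^ p ≤ 1 / Real.exp 1 / (p - 1) + 1 := by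
  have hs : 0 < p - 1 := by linarith
  have hc : 0 < 1 / Real.exp 1 / (p - 1) := by positivity
  have htp : 0 < t ^ p := Real.rpow_pos_of_pos ht p
  rw [div_le_iff₀ htp]
  rcases le_total t 1 with h1 | h1
  · have hl : Real.log (1 + t) ≤ t := by
      have := Real.log_le_sub_one_of_pos (show 0 < 1 + t by linarith)
      linarith
    have h2 : t ^ (2 : ℝ) ≤ t ^ p := Real.rpow_le_rpow_of_exponent_ge ht h1 hp2.le
    rw [Real.rpow_two] at h2
    have h3 : (1 + t) * Real.log (1 + t) ≤ (1 + t) * t :=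
      mul_le_mul_of_nonneg_left hl (by linarith)
    have := mul_pos hc htp
    nlinarith
  · have hl : Real.log (1 + t) ≤ Real.log t + 1 / t := by
      have h := Real.log_le_sub_one_of_pos (show 0 < (1 + t) / t by positivity)
      rw [Real.log_div (by positivity) (by positivity)] at h
      have : (1 + t) / t - 1 = 1 / t := by field_simp; ring
      linarith
    have hlt := Real.log_le_sub_one_of_pos ht
    have h3 : (1 + t) * Real.log (1 + t) ≤ (1 + t) * (Real.log t + 1 / t) :=
      mul_le_mul_of_nonneg_left hl (by linarith)
    have h4 : (1 + t) * (Real.log t + 1 / t) = t * Real.log t + Real.log t + 1 + 1 / t := by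
      field_simp; ring
    have h5 : 1 / t ≤ 1 := by rw [div_le_one ht]; exact h1
    have h6 : 1 ≤ t ^ p := Real.one_le_rpow h1 (by linarith)
    have h7 : t * Real.log t ≤ 1 / Real.exp 1 / (p - 1) * t ^ p := by
      rw [m_aux_pow ht]
      have h := Real.add_one_le_exp ((p - 1) * Real.log t - 1)
      rw [Real.exp_sub] at h
      have h' : Real.log t ≤ Real.exp ((p - 1) * Real.log t) / Real.exp 1 / (p - 1) := by
        rw [le_div_iff₀ hs]; linarith
      calc _ ≤ t * (Real.exp ((p - 1) * Real.log t) / Real.exp 1 / (p - 1)) :=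
            mul_le_mul_of_nonneg_left h' ht.le
        _ = _ := by ring
    linarith

theorem m_aux_lower {p : ℝ} (hp : 1 < p) :
    (1 / (p - 1) - 1) / Real.exp 1 ≤
      ((1 + Real.exp (1 / (p - 1))) * Real.log (1 + Real.exp (1 / (p - 1)))
        - Real.exp (1 / (p - 1))) / Real.exp (1 / (p - 1)) ^ p := by
  have hs : 0 < p - 1 := by linarith
  have ht := Real.exp_pos (1 / (p - 1))
  rw [m_aux_pow ht, Real.log_exp, mul_one_div_cancel hs.ne']
  have hl : 1 / (p - 1) ≤ Real.log (1 + Real.exp (1 / (p - 1))) := by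
    rw [Real.le_log_iff_exp_le (by positivity)]; linarith
  have h0 : 0 < 1 / (p - 1) := by positivity
  generalize Real.exp (1 / (p - 1)) = t at *
  rw [div_le_div_iff₀ (Real.exp_pos 1) (by positivity), ← mul_assoc]
  refine mul_le_mul_of_nonneg_right ?_ (Real.exp_pos 1).le
  nlinarith

/-- The asymptotics (6.14) of the paper: with `B(t) = (1+t)·log(1+t) − t` and
`m(p) = sup_{t>0} B(t)/t^p`, one has `(p−1)·m(p) → 1/e` as `p → 1+`. -/
theorem m_asymptotics :
    Filter.Tendsto
      (fun p : ℝ => (p - 1) *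
        sSup {y : ℝ | ∃ t : ℝ, 0 < t ∧
          y = ((1 + t) * Real.log (1 + t) - t) / t ^ p})
      (nhdsWithin 1 (Set.Ioi 1)) (nhds (1 / Real.exp 1)) := by
  have hev : ∀ᶠ p : ℝ in nhdsWithin 1 (Set.Ioi 1), 1 < p ∧ p < 2 :=
    Ioo_mem_nhdsGT (by norm_num : (1 : ℝ) < 2)
  have hL : Filter.Tendsto (fun p : ℝ => (1 - (p - 1)) / Real.exp 1)
      (nhdsWithin 1 (Set.Ioi 1)) (nhds (1 / Real.exp 1)) := by
    have : Continuous (fun p : ℝ => (1 - (p - 1)) / Real.exp 1) := by fun_prop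
    have h := (this.tendsto 1).mono_left (nhdsWithin_le_nhds (s := Set.Ioi 1))
    simpa using h
  have hU : Filter.Tendsto (fun p : ℝ => 1 / Real.exp 1 + (p - 1))
      (nhdsWithin 1 (Set.Ioi 1)) (nhds (1 / Real.exp 1)) := by
    have : Continuous (fun p : ℝ => 1 / Real.exp 1 + (p - 1)) := by fun_prop
    have h := (this.tendsto 1).mono_left (nhdsWithin_le_nhds (s := Set.Ioi 1))
    simpa using h
  refine tendsto_of_tendsto_of_tendsto_of_le_of_le' hL hU ?_ ?_
  · filter_upwards [hev] with p hp
    have hs : 0 < p - 1 := by linarith [hp.1]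
    have hb : BddAbove {y : ℝ | ∃ t : ℝ, 0 < t ∧
          y = ((1 + t) * Real.log (1 + t) - t) / t ^ p} := by
      refine ⟨1 / Real.exp 1 / (p - 1) + 1, ?_⟩
      rintro y ⟨t, ht, rfl⟩
      exact m_aux_upper hp.1 hp.2 ht
    have h := (m_aux_lower hp.1).trans (le_csSup hb ⟨_, Real.exp_pos (1 / (p - 1)), rfl⟩)
    refine le_trans (le_of_eq ?_) (mul_le_mul_of_nonneg_left h hs.le)
    field_simp
  · filter_upwards [hev] with p hp
    have hs : 0 < p - 1 := by linarith [hp.1]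
    have h : sSup {y : ℝ | ∃ t : ℝ, 0 < t ∧
          y = ((1 + t) * Real.log (1 + t) - t) / t ^ p} ≤ 1 / Real.exp 1 / (p - 1) + 1 := by
      refine csSup_le ⟨_, 1, one_pos, rfl⟩ ?_
      rintro y ⟨t, ht, rfl⟩
      exact m_aux_upper hp.1 hp.2 ht
    refine (mul_le_mul_of_nonneg_left h hs.le).trans (le_of_eq ?_)
    field_simp
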